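/- For every f ∈ L^1_loc(ℝ^n), one has (1/4)·|Df|(ℝ^n) ≤ liminf_{ε→0} K_ε(f). -/

import Mathlib

open MeasureTheory Filter Topology ENNReal

noncomputable section

/-- The standard open cube `(0, ε)^n` in `ℝ^n`. -/
def stdCube (n : ℕ) (ε : ℝ) : Set (EuclideanSpace ℝ (Fin n)) :=
  {x | ∀ i, x i ∈ Set.Ioo (0 : ℝ) ε}

/-- `Q ⊆ ℝ^n` is an `ε`-cube: the image of `(0,ε)^n` under a rigid motion of `ℝ^n`. -/
def IsCube (n : ℕ) (ε : ℝ) (Q : Set (EuclideanSpace ℝ (Fin n))) : Prop :=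
  ∃ T : EuclideanSpace ℝ (Fin n) ≃ᵢ EuclideanSpace ℝ (Fin n), Q = T '' stdCube n ε

/-- The BMO-type energy `K_ε(f)`: the supremum, over all countable families `H` of pairwise
disjoint `ε`-cubes, of `ε^(n-1) * Σ_{Q ∈ H} ⨍_Q |f - ⨍_Q f|`, valued in `[0,∞]`. -/
def K (n : ℕ) (ε : ℝ) (f : EuclideanSpace ℝ (Fin n) → ℝ) : ℝ≥0∞ :=
  ⨆ (H : Set (Set (EuclideanSpace ℝ (Fin n)))) (_ : H.Countable)
    (_ : ∀ Q ∈ H, IsCube n ε Q) (_ : H.Pairwise Disjoint),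
    ENNReal.ofReal (ε ^ (n - 1)) *
      ∑' Q : H, ENNReal.ofReal (⨍ x in (Q : Set (EuclideanSpace ℝ (Fin n))),
        |f x - ⨍ y in (Q : Set (EuclideanSpace ℝ (Fin n))), f y|)

/-- The divergence of a vector field `φ : ℝ^n → ℝ^n`. -/
def div' {n : ℕ} (φ : EuclideanSpace ℝ (Fin n) → EuclideanSpace ℝ (Fin n))
    (x : EuclideanSpace ℝ (Fin n)) : ℝ :=
  ∑ i, fderiv ℝ φ x (EuclideanSpace.single i 1) i

/-- The extended total variation `|Df|(ℝ^n)`, valued in `[0,∞]`. -/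
def totalVariation (n : ℕ) (f : EuclideanSpace ℝ (Fin n) → ℝ) : ℝ≥0∞ :=
  ⨆ (φ : EuclideanSpace ℝ (Fin n) → EuclideanSpace ℝ (Fin n)) (_ : ContDiff ℝ 1 φ)
    (_ : HasCompactSupport φ) (_ : ∀ x, ‖φ x‖ ≤ 1),
    ENNReal.ofReal (∫ x, f x * div' φ x)

variable {n : ℕ}

/-- A box whose sides are parallel to the vectors of the orthonormal basis `b`. -/
def orientedBox (b : OrthonormalBasis (Fin n) ℝ (EuclideanSpace ℝ (Fin n))) (a c : Fin n → ℝ) :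
    Set (EuclideanSpace ℝ (Fin n)) :=
  {y | ∀ i, b.repr y i ∈ Set.Ioo (a i) (c i)}

/-- The open cube of side `ε` with corner `a` in the coordinates of `b`. -/
def orientedCube (b : OrthonormalBasis (Fin n) ℝ (EuclideanSpace ℝ (Fin n))) (a : Fin n → ℝ)
    (ε : ℝ) : Set (EuclideanSpace ℝ (Fin n)) :=
  orientedBox b a (fun i => a i + ε)

lemma orientedBox_eq_preimage (b : OrthonormalBasis (Fin n) ℝ (EuclideanSpace ℝ (Fin n)))
    (a c : Fin n → ℝ) :
    orientedBox b a c = b.repr ⁻¹' ((WithLp.ofLp : EuclideanSpace ℝ (Fin n) → Fin n → ℝ) ⁻¹'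
      Set.univ.pi fun i => Set.Ioo (a i) (c i)) := by
  ext y
  simp only [orientedBox, Set.mem_ofPred_eq, Set.mem_preimage, Set.mem_univ_pi]

lemma isOpen_orientedBox (b : OrthonormalBasis (Fin n) ℝ (EuclideanSpace ℝ (Fin n)))
    (a c : Fin n → ℝ) : IsOpen (orientedBox b a c) := by
  rw [orientedBox_eq_preimage]
  exact ((isOpen_set_pi Set.finite_univ fun i _ => isOpen_Ioo).preimage
    (PiLp.continuous_ofLp 2 _)).preimage b.repr.continuous

lemma measurableSet_orientedBox (b : OrthonormalBasis (Fin n) ℝ (EuclideanSpace ℝ (Fin n)))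
    (a c : Fin n → ℝ) : MeasurableSet (orientedBox b a c) :=
  (isOpen_orientedBox b a c).measurableSet

lemma volume_orientedBox (b : OrthonormalBasis (Fin n) ℝ (EuclideanSpace ℝ (Fin n)))
    (a c : Fin n → ℝ) :
    volume (orientedBox b a c) = ∏ i, ENNReal.ofReal (c i - a i) := by
  have hm : MeasurableSet (Set.univ.pi fun i : Fin n => Set.Ioo (a i) (c i)) :=
    MeasurableSet.univ_pi fun i => measurableSet_Ioo
  rw [orientedBox_eq_preimage, b.measurePreserving_repr.measure_preimage
    ((PiLp.volume_preserving_ofLp (Fin n)).measurable hm).nullMeasurableSet,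
    (PiLp.volume_preserving_ofLp (Fin n)).measure_preimage hm.nullMeasurableSet,
    Real.volume_pi_Ioo]

lemma volume_orientedCube (b : OrthonormalBasis (Fin n) ℝ (EuclideanSpace ℝ (Fin n)))
    (a : Fin n → ℝ) {ε : ℝ} (hε : 0 ≤ ε) :
    volume (orientedCube b a ε) = ENNReal.ofReal (ε ^ n) := by
  simp [orientedCube, volume_orientedBox, ENNReal.ofReal_pow hε]

lemma isCube_orientedCube (b : OrthonormalBasis (Fin n) ℝ (EuclideanSpace ℝ (Fin n)))
    (a : Fin n → ℝ) (ε : ℝ) : IsCube n ε (orientedCube b a ε) := by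
  refine ⟨(IsometryEquiv.addRight (WithLp.toLp 2 a)).trans b.repr.symm.toIsometryEquiv, ?_⟩
  ext y
  constructor
  · intro hy
    refine ⟨b.repr y - WithLp.toLp 2 a, fun i => ?_, by simp⟩
    have := hy i
    simp only [Set.mem_Ioo, PiLp.sub_apply] at this ⊢
    constructor <;> linarith
  · rintro ⟨x, hx, rfl⟩ i
    have := hx i
    simp only [Set.mem_Ioo, IsometryEquiv.trans_apply, IsometryEquiv.addRight_apply,
      LinearIsometryEquiv.coe_toIsometryEquiv, LinearIsometryEquiv.apply_symm_apply,
      PiLp.add_apply] at this ⊢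
    constructor <;> linarith

lemma IsCube.nonempty {ε : ℝ} (hε : 0 < ε) {Q : Set (EuclideanSpace ℝ (Fin n))}
    (hQ : IsCube n ε Q) : Q.Nonempty := by
  obtain ⟨T, rfl⟩ := hQ
  refine Set.Nonempty.image _ ⟨WithLp.toLp 2 fun _ => ε / 2, fun i => ?_⟩
  constructor <;> simp <;> linarith

lemma tsum_le_K {ι : Type*} [Countable ι] {ε : ℝ} (hε : 0 < ε)
    (f : EuclideanSpace ℝ (Fin n) → ℝ) (Q : ι → Set (EuclideanSpace ℝ (Fin n)))
    (hQ : ∀ i, IsCube n ε (Q i)) (hd : Pairwise (Function.onFun Disjoint Q)) :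
    ENNReal.ofReal (ε ^ (n - 1)) *
      ∑' i, ENNReal.ofReal (⨍ x in Q i, |f x - ⨍ y in Q i, f y|) ≤ K n ε f := by
  have hinj : Function.Injective Q := by
    intro i j hij
    by_contra hne
    have h := hd hne
    simp only [Function.onFun, hij, disjoint_self] at h
    exact ((hQ j).nonempty hε).ne_empty h
  rw [← tsum_range (g := Q)
    (fun S => ENNReal.ofReal (⨍ x in S, |f x - ⨍ y in S, f y|)) hinj]
  unfold K
  refine le_iSup_of_le (Set.range Q) (le_iSup_of_le (Set.countable_range Q)
    (le_iSup_of_le ?_ (le_iSup_of_le ?_ le_rfl)))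
  · rintro _ ⟨i, rfl⟩
    exact hQ i
  · rintro _ ⟨i, rfl⟩ _ ⟨j, rfl⟩ hne
    exact hd fun h => hne (by rw [h])

lemma setAverage_comp_sub (f : EuclideanSpace ℝ (Fin n) → ℝ) (t : EuclideanSpace ℝ (Fin n))
    (S : Set (EuclideanSpace ℝ (Fin n))) :
    ⨍ x in S, f (x - t) = ⨍ x in (fun y => y + t) ⁻¹' S, f x := by
  have hp := measurePreserving_add_right (volume : Measure (EuclideanSpace ℝ (Fin n))) t
  have he : MeasurableEmbedding fun y : EuclideanSpace ℝ (Fin n) => y + t :=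
    (MeasurableEquiv.addRight t).measurableEmbedding
  have h1 := hp.setIntegral_preimage_emb he (fun x => f (x - t)) S
  have h2 : volume.real ((fun y => y + t) ⁻¹' S) = volume.real S := by
    simp only [Measure.real]
    rw [hp.measure_preimage_emb he]
  simp only [add_sub_cancel_right] at h1
  rw [setAverage_eq, setAverage_eq, h1, h2]

lemma K_comp_sub_le {ε : ℝ} (hε : 0 < ε) (f : EuclideanSpace ℝ (Fin n) → ℝ)
    (t : EuclideanSpace ℝ (Fin n)) : K n ε (fun x => f (x - t)) ≤ K n ε f := by
  conv_lhs => unfold K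
  refine iSup_le fun H => iSup_le fun hH => iSup_le fun hQ => iSup_le fun hd => ?_
  have := hH.to_subtype
  refine le_trans (le_of_eq ?_) (tsum_le_K hε f
    (fun Q : H => (fun y => y + t) ⁻¹' (Q : Set (EuclideanSpace ℝ (Fin n)))) ?_ ?_)
  · congr 2
    ext Q
    rw [setAverage_comp_sub f t,
      setAverage_comp_sub (fun x => |f x - ⨍ y in (fun y => y + t) ⁻¹' (Q : Set _), f y|) t]
  · rintro ⟨Q, hQH⟩
    obtain ⟨T, rfl⟩ := hQ Q hQH
    refine ⟨T.trans (IsometryEquiv.addRight (-t)), ?_⟩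
    ext y
    simp only [Set.mem_preimage, Set.mem_image, IsometryEquiv.trans_apply,
      IsometryEquiv.addRight_apply, ← sub_eq_add_neg, sub_eq_iff_eq_add]
  · intro P Q hne
    exact (hd P.2 Q.2 fun h => hne (Subtype.ext h)).preimage _

/-- The half of `orientedCube b a ε` on the negative side of its middle section orthogonal to
`b 0`. -/
def lowerHalf [NeZero n] (b : OrthonormalBasis (Fin n) ℝ (EuclideanSpace ℝ (Fin n)))
    (a : Fin n → ℝ) (ε : ℝ) : Set (EuclideanSpace ℝ (Fin n)) :=
  orientedBox b a (fun i => a i + if i = 0 then ε / 2 else ε)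

/-- The half of `orientedCube b a ε` on the positive side of its middle section orthogonal to
`b 0`. -/
def upperHalf [NeZero n] (b : OrthonormalBasis (Fin n) ℝ (EuclideanSpace ℝ (Fin n)))
    (a : Fin n → ℝ) (ε : ℝ) : Set (EuclideanSpace ℝ (Fin n)) :=
  orientedBox b (fun i => a i + if i = 0 then ε / 2 else 0) (fun i => a i + ε)

/-- The function equal to `1` on the upper half and to `-1` on the lower half of a cube. -/
def halfSign [NeZero n] (b : OrthonormalBasis (Fin n) ℝ (EuclideanSpace ℝ (Fin n)))
    (a : Fin n → ℝ) (ε : ℝ) (x : EuclideanSpace ℝ (Fin n)) : ℝ :=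
  (upperHalf b a ε).indicator 1 x - (lowerHalf b a ε).indicator 1 x

lemma orientedCube_subset_closedBall
    (b : OrthonormalBasis (Fin n) ℝ (EuclideanSpace ℝ (Fin n))) (a : Fin n → ℝ) (ε : ℝ) :
    ∃ R : ℝ, orientedCube b a ε ⊆ Metric.closedBall 0 R := by
  refine ⟨‖WithLp.toLp 2 (fun i => |a i| + |ε|)‖, fun y hy => ?_⟩
  rw [mem_closedBall_zero_iff, ← b.repr.norm_map, EuclideanSpace.norm_eq, EuclideanSpace.norm_eq]
  refine Real.sqrt_le_sqrt (Finset.sum_le_sum fun i _ => ?_)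
  have := hy i
  simp only [Set.mem_Ioo, Real.norm_eq_abs, sq_abs] at this ⊢
  rw [sq_le_sq, abs_of_nonneg (a := |a i| + |ε|) (by positivity), abs_le]
  constructor <;> linarith [neg_abs_le (a i), le_abs_self (a i), neg_abs_le ε, le_abs_self ε]

lemma integrableOn_orientedCube
    (b : OrthonormalBasis (Fin n) ℝ (EuclideanSpace ℝ (Fin n))) (a : Fin n → ℝ) {ε : ℝ}
    {f : EuclideanSpace ℝ (Fin n) → ℝ}
    (hf : LocallyIntegrable f volume) : IntegrableOn f (orientedCube b a ε) := by
  obtain ⟨R, hR⟩ := orientedCube_subset_closedBall b a ε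
  exact (hf.integrableOn_isCompact (isCompact_closedBall 0 R)).mono_set hR

section Halves

variable [NeZero n] (b : OrthonormalBasis (Fin n) ℝ (EuclideanSpace ℝ (Fin n)))
  (a : Fin n → ℝ) {ε : ℝ}

lemma lowerHalf_subset : lowerHalf b a ε ⊆ orientedCube b a ε := by
  intro y hy i
  have := hy i
  simp only [Set.mem_Ioo] at this ⊢
  split_ifs at this <;> constructor <;> linarith

lemma upperHalf_subset : upperHalf b a ε ⊆ orientedCube b a ε := by
  intro y hy i
  have := hy i
  simp only [Set.mem_Ioo] at this ⊢
  split_ifs at this <;> constructor <;> linarith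

lemma disjoint_upperHalf_lowerHalf : Disjoint (upperHalf b a ε) (lowerHalf b a ε) := by
  rw [Set.disjoint_left]
  intro y hy hy'
  have h1 := (hy 0).1
  have h2 := (hy' 0).2
  simp only [if_true] at h1 h2
  linarith

lemma add_mem_upperHalf_iff (y : EuclideanSpace ℝ (Fin n)) :
    y + (ε / 2) • b 0 ∈ upperHalf b a ε ↔ y ∈ lowerHalf b a ε := by
  refine forall_congr' fun i => ?_
  simp only [map_add, map_smul, OrthonormalBasis.repr_self, PiLp.add_apply, PiLp.smul_apply,
    PiLp.single_apply, smul_eq_mul, Set.mem_Ioo]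
  split_ifs <;> constructor <;> rintro ⟨h1, h2⟩ <;> constructor <;> linarith

lemma preimage_upperHalf :
    (fun y => y + (ε / 2) • b 0) ⁻¹' upperHalf b a ε = lowerHalf b a ε :=
  Set.ext fun y => add_mem_upperHalf_iff b a y

lemma volume_lowerHalf (hε : 0 < ε) :
    volume (lowerHalf b a ε) = ENNReal.ofReal (ε ^ n / 2) := by
  obtain ⟨m, rfl⟩ : ∃ m, n = m + 1 := Nat.exists_eq_succ_of_ne_zero (NeZero.ne n)
  rw [lowerHalf, volume_orientedBox, ← ENNReal.ofReal_prod_of_nonneg]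
  · congr 1
    rw [Fin.prod_univ_succ]
    simp [Fin.succ_ne_zero]
    ring
  · intro i _
    split_ifs <;> linarith

lemma volume_upperHalf (hε : 0 < ε) :
    volume (upperHalf b a ε) = ENNReal.ofReal (ε ^ n / 2) := by
  rw [← volume_lowerHalf b a hε, ← preimage_upperHalf]
  exact ((measurePreserving_add_right volume _).measure_preimage
    (measurableSet_orientedBox b _ _).nullMeasurableSet).symm

lemma measurable_halfSign : Measurable (halfSign b a ε) :=
  (measurable_one.indicator (measurableSet_orientedBox b _ _)).sub
    (measurable_one.indicator (measurableSet_orientedBox b _ _))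

lemma abs_halfSign_le (x : EuclideanSpace ℝ (Fin n)) :
    |halfSign b a ε x| ≤ (orientedCube b a ε).indicator 1 x := by
  have h1 := @upperHalf_subset n _ b a ε x
  have h2 := @lowerHalf_subset n _ b a ε x
  have h3 := Set.disjoint_left.1 (disjoint_upperHalf_lowerHalf (ε := ε) b a)
  specialize @h3 x
  by_cases hu : x ∈ upperHalf b a ε <;> by_cases hl : x ∈ lowerHalf b a ε <;>
    by_cases hc : x ∈ orientedCube b a ε <;> simp_all [halfSign]

lemma integral_mul_halfSign {f : EuclideanSpace ℝ (Fin n) → ℝ}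
    (hf : LocallyIntegrable f volume) :
    ∫ x, f x * halfSign b a ε x = (∫ x in upperHalf b a ε, f x) - ∫ x in lowerHalf b a ε, f x := by
  have hU : MeasurableSet (upperHalf b a ε) := measurableSet_orientedBox b _ _
  have hL : MeasurableSet (lowerHalf b a ε) := measurableSet_orientedBox b _ _
  have hQ := integrableOn_orientedCube (ε := ε) b a hf
  rw [← integral_indicator hU, ← integral_indicator hL, ← integral_sub
    ((hQ.mono_set (upperHalf_subset b a)).integrable_indicator hU)
    ((hQ.mono_set (lowerHalf_subset b a)).integrable_indicator hL)]
  congr 1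
  ext x
  by_cases hu : x ∈ upperHalf b a ε <;> by_cases hl : x ∈ lowerHalf b a ε <;>
    simp [halfSign, hu, hl]

lemma integral_mul_halfSign_le (hε : 0 < ε) {f : EuclideanSpace ℝ (Fin n) → ℝ}
    (hf : LocallyIntegrable f volume) :
    ∫ x, f x * halfSign b a ε x ≤
      ε ^ n * ⨍ x in orientedCube b a ε, |f x - ⨍ y in orientedCube b a ε, f y| := by
  set Q := orientedCube b a ε with hQdef
  set c := ⨍ y in Q, f y
  have hQm : MeasurableSet Q := measurableSet_orientedBox b _ _
  have hvQ : volume Q = ENNReal.ofReal (ε ^ n) := volume_orientedCube b a hε.le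
  have hc : LocallyIntegrable (fun _ : EuclideanSpace ℝ (Fin n) => c) volume :=
    locallyIntegrable_const c
  have hfc : LocallyIntegrable (fun x => f x - c) volume := hf.sub hc
  have h0 : ∫ x, c * halfSign b a ε x = 0 := by
    rw [integral_mul_halfSign b a hc]
    simp [Measure.real, volume_upperHalf b a hε, volume_lowerHalf b a hε]
  have hint : ∀ {h : EuclideanSpace ℝ (Fin n) → ℝ}, LocallyIntegrable h volume →
      Integrable (fun x => h x * halfSign b a ε x) := by
    intro h hh
    have h1 : Integrable (Q.indicator h) :=
      (integrableOn_orientedCube b a hh).integrable_indicator hQm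
    refine (h1.mul_bdd (c := 1) (measurable_halfSign b a (ε := ε)).aestronglyMeasurable
      (.of_forall fun x => ?_)).congr (.of_forall fun x => ?_)
    · exact (abs_halfSign_le b a (ε := ε) x).trans (Set.indicator_le_self' (by simp) x)
    · by_cases hx : x ∈ Q
      · simp [hx]
      · have := abs_halfSign_le b a (ε := ε) x
        rw [Set.indicator_of_notMem hx] at this
        simp [hx, abs_nonpos_iff.1 this]
  have h1 : ∫ x, f x * halfSign b a ε x = ∫ x, (f x - c) * halfSign b a ε x := by
    simp only [sub_mul]
    rw [integral_sub (hint hf) (hint hc), h0, sub_zero]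
  have h2 : ∫ x, (f x - c) * halfSign b a ε x ≤ ∫ x, Q.indicator (fun x => |f x - c|) x := by
    refine integral_mono (hint hfc)
      (IntegrableOn.integrable_indicator (integrableOn_orientedCube b a hfc).abs hQm) fun x => ?_
    refine (le_abs_self _).trans ?_
    simp only [abs_mul]
    refine (mul_le_mul_of_nonneg_left (abs_halfSign_le b a (ε := ε) x) (abs_nonneg _)).trans ?_
    by_cases hx : x ∈ Q <;> simp [← hQdef, hx]
  rw [h1]
  refine h2.trans (le_of_eq ?_)
  rw [integral_indicator hQm, setAverage_eq, Measure.real, hvQ,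
    ENNReal.toReal_ofReal (by positivity), smul_eq_mul, mul_inv_cancel_left₀ (by positivity)]

lemma le_integral_mul_halfSign (hε : 0 < ε) {g : EuclideanSpace ℝ (Fin n) → ℝ}
    (hg : ContDiff ℝ 1 g) {m : ℝ} (hm : ∀ y ∈ orientedCube b a ε, m ≤ fderiv ℝ g y (b 0)) :
    ε ^ n * (ε * (m / 4)) ≤ ∫ x, g x * halfSign b a ε x := by
  have hdiff : Differentiable ℝ g := hg.differentiable one_ne_zero
  have hloc : LocallyIntegrable g volume := hg.continuous.locallyIntegrable
  have hL : MeasurableSet (lowerHalf b a ε) := measurableSet_orientedBox b _ _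
  set h : EuclideanSpace ℝ (Fin n) := (ε / 2) • b 0 with hh
  have hlocL := (integrableOn_orientedCube (ε := ε) b a hloc).mono_set (lowerHalf_subset b a)
  have hlocT : IntegrableOn (fun x => g (x + h)) (lowerHalf b a ε) :=
    (integrableOn_orientedCube (ε := ε) b a
      (hg.continuous.comp (continuous_add_const h)).locallyIntegrable).mono_set
      (lowerHalf_subset b a)
  have hshift : ∫ x in upperHalf b a ε, g x = ∫ x in lowerHalf b a ε, g (x + h) := by
    rw [← preimage_upperHalf]
    exact ((measurePreserving_add_right volume h).setIntegral_preimage_emb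
      (MeasurableEquiv.addRight h).measurableEmbedding g _).symm
  rw [integral_mul_halfSign b a hloc, hshift, ← integral_sub hlocT hlocL]
  have hpt : ∀ x ∈ lowerHalf b a ε, m * (ε / 2) ≤ g (x + h) - g x := by
    intro x hx
    have hline : ∀ s : ℝ, HasDerivAt (fun s : ℝ => g (x + s • b 0))
        (fderiv ℝ g (x + s • b 0) (b 0)) s := by
      intro s
      have h1 : HasDerivAt (fun s : ℝ => x + s • b 0) (b 0) s := by
        simpa using ((hasDerivAt_id s).smul_const (b 0)).const_add x
      exact (hdiff _).hasFDerivAt.comp_hasDerivAt s h1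
    have := (convex_Icc (0 : ℝ) (ε / 2)).mul_sub_le_image_sub_of_le_deriv
      (f := fun s : ℝ => g (x + s • b 0)) (C := m)
      (fun s _ => (hline s).continuousAt.continuousWithinAt)
      (fun s _ => (hline s).differentiableAt.differentiableWithinAt) ?_ 0
      (Set.left_mem_Icc.2 (by positivity)) (ε / 2) (Set.right_mem_Icc.2 (by positivity))
      (by positivity)
    · simpa [hh] using this
    · intro s hs
      rw [interior_Icc] at hs
      rw [(hline s).deriv]
      refine hm _ fun i => ?_
      have := hx i
      simp only [map_add, map_smul, OrthonormalBasis.repr_self, PiLp.add_apply, PiLp.smul_apply,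
        PiLp.single_apply, smul_eq_mul, Set.mem_Ioo] at this hs ⊢
      split_ifs at this ⊢ <;> constructor <;> linarith
  have hfin : volume (lowerHalf b a ε) ≠ ∞ := by simp [volume_lowerHalf b a hε]
  have := setIntegral_mono_on (integrableOn_const (C := m * (ε / 2)) hfin) (hlocT.sub hlocL) hL hpt
  rw [setIntegral_const, Measure.real, volume_lowerHalf b a hε,
    ENNReal.toReal_ofReal (by positivity), smul_eq_mul] at this
  refine le_trans (le_of_eq ?_) this
  ring

end Halves

lemma ofReal_integral_le_lintegral {α : Type*} [MeasurableSpace α] {μ : Measure α} (h : α → ℝ) :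
    ENNReal.ofReal (∫ x, h x ∂μ) ≤ ∫⁻ x, ENNReal.ofReal (h x) ∂μ := by
  by_cases hi : Integrable h μ
  · rw [integral_eq_lintegral_pos_part_sub_lintegral_neg_part hi]
    refine (ENNReal.ofReal_le_ofReal (sub_le_self _ ENNReal.toReal_nonneg)).trans ?_
    exact ENNReal.ofReal_toReal_le
  · simp [integral_undef hi]

lemma sum_lintegral_le_lintegral_sum {α ι : Type*} [MeasurableSpace α] {μ : Measure α}
    (s : Finset ι) (h : ι → α → ℝ≥0∞) :
    ∑ i ∈ s, ∫⁻ x, h i x ∂μ ≤ ∫⁻ x, ∑ i ∈ s, h i x ∂μ := by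
  classical
  induction s using Finset.induction_on with
  | empty => simp
  | insert i s hi ih =>
    simp only [Finset.sum_insert hi]
    exact (add_le_add_right ih _).trans (le_lintegral_add _ _)

open scoped Convolution in
lemma integral_convolution_mul {ρ f ψ : EuclideanSpace ℝ (Fin n) → ℝ} (hρ : Continuous ρ)
    (hρs : HasCompactSupport ρ) (hf : LocallyIntegrable f volume) (hψ : AEStronglyMeasurable ψ)
    {C R : ℝ} (hψC : ∀ x, ‖ψ x‖ ≤ C) (hψR : ∀ x, ψ x ≠ 0 → x ∈ Metric.closedBall 0 R) :
    ∫ x, (ρ ⋆[ContinuousLinearMap.mul ℝ ℝ, volume] f) x * ψ x =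
      ∫ t, ρ t * ∫ x, f (x - t) * ψ x := by
  obtain ⟨S, hS⟩ := hρs.isCompact.isBounded.subset_closedBall (0 : EuclideanSpace ℝ (Fin n))
  set B := Metric.closedBall (0 : EuclideanSpace ℝ (Fin n)) (R + S)
  have hF : Integrable (B.indicator f) :=
    (hf.integrableOn_isCompact (isCompact_closedBall _ _)).integrable_indicator
      measurableSet_closedBall
  have h1 := (hρ.integrable_of_hasCompactSupport hρs (μ := volume)).convolution_integrand
    (ContinuousLinearMap.mul ℝ ℝ) hF
  have h2 : Integrable (fun p : EuclideanSpace ℝ (Fin n) × EuclideanSpace ℝ (Fin n) =>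
      ρ p.2 * f (p.1 - p.2) * ψ p.1) (volume.prod volume) := by
    refine (h1.mul_bdd (c := C) (g := fun p => ψ p.1) hψ.comp_fst
      (.of_forall fun p => hψC p.1)).congr (.of_forall fun p => ?_)
    simp only [ContinuousLinearMap.mul_apply']
    by_cases hp1 : ψ p.1 = 0
    · simp [hp1]
    by_cases hp2 : ρ p.2 = 0
    · simp [hp2]
    have hB : p.1 - p.2 ∈ B := by
      have h3 := hψR _ hp1
      have h4 := hS (subset_tsupport ρ hp2)
      rw [mem_closedBall_zero_iff] at h3 h4 ⊢
      exact (norm_sub_le _ _).trans (add_le_add h3 h4)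
    rw [Set.indicator_of_mem hB]
  calc ∫ x, (ρ ⋆[ContinuousLinearMap.mul ℝ ℝ, volume] f) x * ψ x
      = ∫ x, ∫ t, ρ t * f (x - t) * ψ x := by
        simp only [convolution_def, ContinuousLinearMap.mul_apply', integral_mul_const]
    _ = ∫ t, ∫ x, ρ t * f (x - t) * ψ x := integral_integral_swap h2
    _ = _ := by simp only [mul_assoc, integral_const_mul]

lemma ae_exists_mem_orientedCube {ε : ℝ} (hε : 0 < ε)
    (b : OrthonormalBasis (Fin n) ℝ (EuclideanSpace ℝ (Fin n))) :
    ∀ᵐ y, ∃ k : Fin n → ℤ, y ∈ orientedCube b (fun i => ε * k i) ε := by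
  have h1 : ∀ᵐ z : Fin n → ℝ, ∀ i, ∀ k : ℤ, z i ≠ ε * k :=
    ae_all_iff.2 fun i => ae_all_iff.2 fun k => Measure.ae_eval_ne _ i _
  have h2 := ((PiLp.volume_preserving_ofLp (Fin n)).comp
    b.measurePreserving_repr).quasiMeasurePreserving.ae h1
  filter_upwards [h2] with y hy
  refine ⟨fun i => ⌊b.repr y i / ε⌋, fun i => ?_⟩
  have h3 := Int.floor_le (b.repr y i / ε)
  have h4 := Int.lt_floor_add_one (b.repr y i / ε)
  rw [le_div_iff₀ hε] at h3
  rw [div_lt_iff₀ hε] at h4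
  refine ⟨lt_of_le_of_ne (by linarith) (hy i _).symm, by linarith⟩

lemma disjoint_orientedCube {ε : ℝ} (hε : 0 < ε)
    (b : OrthonormalBasis (Fin n) ℝ (EuclideanSpace ℝ (Fin n))) {k l : Fin n → ℤ} (hkl : k ≠ l) :
    Disjoint (orientedCube b (fun i => ε * k i) ε) (orientedCube b (fun i => ε * l i) ε) := by
  rw [Set.disjoint_left]
  intro y hy hy'
  refine hkl (funext fun i => ?_)
  have h1 := hy i
  have h2 := hy' i
  have h3 : ε * (k i : ℝ) < ε * (l i + 1) := by linarith [h1.1, h2.2]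
  have h4 : ε * (l i : ℝ) < ε * (k i + 1) := by linarith [h2.1, h1.2]
  have h5 := lt_of_mul_lt_mul_left h3 hε.le
  have h6 := lt_of_mul_lt_mul_left h4 hε.le
  norm_cast at h5 h6
  omega

lemma dist_le_of_mem_orientedCube {ε : ℝ} (hε : 0 < ε)
    {b : OrthonormalBasis (Fin n) ℝ (EuclideanSpace ℝ (Fin n))} {a : Fin n → ℝ}
    {y z : EuclideanSpace ℝ (Fin n)} (hy : y ∈ orientedCube b a ε)
    (hz : z ∈ orientedCube b a ε) : dist y z ≤ √n * ε := by
  rw [← b.repr.dist_map, EuclideanSpace.dist_eq]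
  refine Real.sqrt_le_iff.2 ⟨by positivity, ?_⟩
  rw [mul_pow, Real.sq_sqrt (by positivity)]
  have : ∀ i ∈ Finset.univ, dist (b.repr y i) (b.repr z i) ^ 2 ≤ ε ^ 2 := by
    intro i _
    have h1 := hy i
    have h2 := hz i
    refine pow_le_pow_left₀ dist_nonneg ?_ 2
    rw [Real.dist_eq, abs_le]
    constructor <;> linarith [h1.1, h1.2, h2.1, h2.2]
  simpa using Finset.sum_le_sum this

lemma volume_ball_le_tsum_orientedCube {ε : ℝ} (hε : 0 < ε)
    (b : OrthonormalBasis (Fin n) ℝ (EuclideanSpace ℝ (Fin n))) (x : EuclideanSpace ℝ (Fin n))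
    (r : ℝ) :
    volume (Metric.ball x (r - √n * ε)) ≤
      ∑' k : {k : Fin n → ℤ // orientedCube b (fun i => ε * k i) ε ⊆ Metric.ball x r},
        volume (orientedCube b (fun i => ε * k.1 i) ε) := by
  refine le_trans (measure_mono_ae ?_) (measure_iUnion_le _)
  filter_upwards [ae_exists_mem_orientedCube hε b] with y ⟨k, hk⟩ hy
  refine Set.mem_iUnion.2 ⟨⟨k, fun z hz => ?_⟩, hk⟩
  have h1 := dist_le_of_mem_orientedCube hε hz hk
  have h2 : dist y x < r - √n * ε := hy
  rw [Metric.mem_ball]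
  linarith [dist_triangle z y x]

lemma tendsto_volume_ball_sub (x : EuclideanSpace ℝ (Fin n)) {r : ℝ} (hr : 0 < r) (c : ℝ) :
    Tendsto (fun ε : ℝ => volume (Metric.ball x (r - c * ε))) (𝓝[>] 0)
      (𝓝 (volume (Metric.ball x r))) := by
  have hlim : Tendsto (fun ε : ℝ => r - c * ε) (𝓝[>] 0) (𝓝 r) := by
    have : Continuous fun ε : ℝ => r - c * ε := by fun_prop
    simpa using (this.tendsto 0).mono_left nhdsWithin_le_nhds
  have hev : ∀ᶠ ε in 𝓝[>] (0 : ℝ), 0 < r - c * ε := hlim.eventually (lt_mem_nhds hr)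
  rw [Measure.addHaar_ball_of_pos _ _ hr]
  refine Tendsto.congr' (hev.mono fun ε h => (Measure.addHaar_ball_of_pos _ _ h).symm) ?_
  exact ENNReal.Tendsto.mul_const (ENNReal.tendsto_ofReal (hlim.pow _))
    (Or.inr measure_ball_lt_top.ne)

lemma exists_orthonormalBasis_apply_eq_norm [NeZero n]
    (L : EuclideanSpace ℝ (Fin n) →L[ℝ] ℝ) :
    ∃ b : OrthonormalBasis (Fin n) ℝ (EuclideanSpace ℝ (Fin n)), L (b 0) = ‖L‖ := by
  by_cases hL : L = 0
  · exact ⟨EuclideanSpace.basisFun (Fin n) ℝ, by simp [hL]⟩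
  set w := (InnerProductSpace.toDual ℝ (EuclideanSpace ℝ (Fin n))).symm L with hw
  have hwL : ∀ y, inner ℝ w y = L y := fun y => InnerProductSpace.toDual_symm_apply
  have hwn : ‖w‖ = ‖L‖ := LinearIsometryEquiv.norm_map _ _
  have hpos : ‖w‖ ≠ 0 := by rw [hwn]; exact norm_ne_zero_iff.2 hL
  have hv : Orthonormal ℝ (({0} : Set (Fin n)).domRestrict fun _ => ‖w‖⁻¹ • w) := by
    refine ⟨fun i => ?_, fun i j hij => (hij (Subsingleton.elim i j)).elim⟩
    simp [norm_smul, hpos]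
  obtain ⟨b, hb⟩ := hv.exists_orthonormalBasis_extension_of_card_eq (by simp)
  refine ⟨b, ?_⟩
  rw [hb 0 rfl, ← hwL, inner_smul_right, real_inner_self_eq_norm_sq, ← hwn]
  field_simp

section Mollified

variable [NeZero n] {ε : ℝ} {f ρ : EuclideanSpace ℝ (Fin n) → ℝ}

lemma tsum_integral_mul_halfSign_le_K {ι : Type*} [Countable ι] (hε : 0 < ε)
    (hf : LocallyIntegrable f volume)
    (b : ι → OrthonormalBasis (Fin n) ℝ (EuclideanSpace ℝ (Fin n))) (a : ι → Fin n → ℝ)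
    (hd : Pairwise (Function.onFun Disjoint fun i => orientedCube (b i) (a i) ε)) :
    ∑' i, ENNReal.ofReal (∫ x, f x * halfSign (b i) (a i) ε x) ≤ ENNReal.ofReal ε * K n ε f := by
  refine le_trans ?_ (mul_le_mul_right (tsum_le_K hε f (fun i => orientedCube (b i) (a i) ε)
    (fun i => isCube_orientedCube _ _ _) hd) _)
  rw [← ENNReal.tsum_mul_left, ← ENNReal.tsum_mul_left]
  refine ENNReal.tsum_le_tsum fun i => ?_
  rw [← mul_assoc, ← ENNReal.ofReal_mul hε.le, ← pow_succ', Nat.sub_add_cancel (NeZero.one_le),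
    ← ENNReal.ofReal_mul (by positivity)]
  exact ENNReal.ofReal_le_ofReal (integral_mul_halfSign_le (b i) (a i) hε hf)

open scoped Convolution in
lemma tsum_integral_convolution_mul_halfSign_le_K {ι : Type*} [Countable ι] (hε : 0 < ε)
    (hf : LocallyIntegrable f volume) (hρ : Continuous ρ) (hρs : HasCompactSupport ρ)
    (hρ0 : ∀ x, 0 ≤ ρ x) (hρ1 : ∫ x, ρ x = 1)
    (b : ι → OrthonormalBasis (Fin n) ℝ (EuclideanSpace ℝ (Fin n))) (a : ι → Fin n → ℝ)
    (hd : Pairwise (Function.onFun Disjoint fun i => orientedCube (b i) (a i) ε)) :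
    ∑' i, ENNReal.ofReal
      (∫ x, (ρ ⋆[ContinuousLinearMap.mul ℝ ℝ, volume] f) x * halfSign (b i) (a i) ε x) ≤
      ENNReal.ofReal ε * K n ε f := by
  have hρl : ∫⁻ t, ENNReal.ofReal (ρ t) = 1 := by
    rw [← ofReal_integral_eq_lintegral_ofReal (hρ.integrable_of_hasCompactSupport hρs)
      (.of_forall hρ0), hρ1, ENNReal.ofReal_one]
  have hterm : ∀ i, ENNReal.ofReal
      (∫ x, (ρ ⋆[ContinuousLinearMap.mul ℝ ℝ, volume] f) x * halfSign (b i) (a i) ε x) ≤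
      ∫⁻ t, ENNReal.ofReal (ρ t) *
        ENNReal.ofReal (∫ x, f (x - t) * halfSign (b i) (a i) ε x) := by
    intro i
    obtain ⟨R, hR⟩ := orientedCube_subset_closedBall (b i) (a i) ε
    have hle := abs_halfSign_le (b i) (a i) (ε := ε)
    rw [integral_convolution_mul hρ hρs hf (measurable_halfSign (b i) (a i)).aestronglyMeasurable
      (C := 1) (R := R)
      (fun x => (hle x).trans (Set.indicator_le_self' (by simp) x))
      (fun x hx => hR ?_)]
    · refine (ofReal_integral_le_lintegral _).trans (le_of_eq ?_)
      simp only [ENNReal.ofReal_mul (hρ0 _)]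
    · by_contra hxQ
      have := hle x
      rw [Set.indicator_of_notMem hxQ] at this
      exact hx (abs_nonpos_iff.1 this)
  rw [ENNReal.tsum_eq_iSup_sum]
  refine iSup_le fun s => ?_
  calc ∑ i ∈ s, ENNReal.ofReal
        (∫ x, (ρ ⋆[ContinuousLinearMap.mul ℝ ℝ, volume] f) x * halfSign (b i) (a i) ε x)
      ≤ ∑ i ∈ s, ∫⁻ t, ENNReal.ofReal (ρ t) *
        ENNReal.ofReal (∫ x, f (x - t) * halfSign (b i) (a i) ε x) :=
        Finset.sum_le_sum fun i _ => hterm i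
    _ ≤ ∫⁻ t, ∑ i ∈ s, ENNReal.ofReal (ρ t) *
        ENNReal.ofReal (∫ x, f (x - t) * halfSign (b i) (a i) ε x) :=
        sum_lintegral_le_lintegral_sum _ _
    _ ≤ ∫⁻ t, ENNReal.ofReal (ρ t) * (ENNReal.ofReal ε * K n ε f) := by
        refine lintegral_mono fun t => ?_
        simp only [← Finset.mul_sum]
        gcongr
        have hft : LocallyIntegrable (fun x => f (x - t)) volume := by
          refine (locallyIntegrable_map_homeomorph (Homeomorph.subRight t)).1 ?_
          have := (measurePreserving_sub_right
            (volume : Measure (EuclideanSpace ℝ (Fin n))) t).map_eq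
          simpa only [Homeomorph.coe_subRight, this] using hf
        refine (ENNReal.sum_le_tsum s).trans
          ((tsum_integral_mul_halfSign_le_K hε hft b a hd).trans ?_)
        gcongr
        exact K_comp_sub_le hε f t
    _ = ENNReal.ofReal ε * K n ε f := by
        rw [lintegral_mul_const _ (by fun_prop), hρl, one_mul]

open scoped Convolution in
lemma tsum_mul_volume_ball_le_K {ι : Type*} [Countable ι] (hε : 0 < ε)
    (hf : LocallyIntegrable f volume) (hρ : ContDiff ℝ 1 ρ) (hρs : HasCompactSupport ρ)
    (hρ0 : ∀ x, 0 ≤ ρ x) (hρ1 : ∫ x, ρ x = 1)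
    (b : ι → OrthonormalBasis (Fin n) ℝ (EuclideanSpace ℝ (Fin n)))
    (x : ι → EuclideanSpace ℝ (Fin n)) (r m : ι → ℝ)
    (hd : Pairwise (Function.onFun Disjoint fun i => Metric.ball (x i) (r i)))
    (hm : ∀ i, ∀ y ∈ Metric.ball (x i) (r i),
      m i ≤ fderiv ℝ (ρ ⋆[ContinuousLinearMap.mul ℝ ℝ, volume] f) y (b i 0)) :
    ∑' i, ENNReal.ofReal (m i / 4) * volume (Metric.ball (x i) (r i - √n * ε)) ≤ K n ε f := by
  have hg : ContDiff ℝ 1 (ρ ⋆[ContinuousLinearMap.mul ℝ ℝ, volume] f) :=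
    hρs.contDiff_convolution_left _ (n := 1) hρ hf
  have key := tsum_integral_convolution_mul_halfSign_le_K
    (ι := Σ i, {k : Fin n → ℤ //
      orientedCube (b i) (fun j => ε * k j) ε ⊆ Metric.ball (x i) (r i)})
    hε hf hρ.continuous hρs hρ0 hρ1 (fun p => b p.1) (fun p j => ε * p.2.1 j) ?_
  · have hε0 : ENNReal.ofReal ε ≠ 0 := by simpa using hε
    rw [← ENNReal.mul_le_mul_iff_right hε0 ENNReal.ofReal_ne_top]
    refine le_trans ?_ key
    rw [ENNReal.tsum_sigma', ← ENNReal.tsum_mul_left]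
    refine ENNReal.tsum_le_tsum fun i => ?_
    refine (mul_le_mul_right (mul_le_mul_right
      (volume_ball_le_tsum_orientedCube hε (b i) (x i) (r i)) _) _).trans ?_
    rw [← ENNReal.tsum_mul_left, ← ENNReal.tsum_mul_left]
    refine ENNReal.tsum_le_tsum fun k => ?_
    refine le_trans (le_of_eq ?_) (ENNReal.ofReal_le_ofReal (le_integral_mul_halfSign (b i)
      (fun j => ε * k.1 j) hε hg (m := m i) fun y hy => hm i y (k.2 hy)))
    rw [volume_orientedCube _ _ hε.le, ENNReal.ofReal_mul (by positivity),
      ENNReal.ofReal_mul hε.le]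
    ring
  · rintro ⟨i, k⟩ ⟨j, l⟩ hne
    simp only [Function.onFun]
    by_cases hij : i = j
    · subst hij
      exact disjoint_orientedCube hε (b i) fun h => hne (by rw [Subtype.ext h])
    · exact (hd hij).mono k.2 l.2

open scoped Convolution in
lemma lintegral_norm_fderiv_convolution_sub_le
    (hf : LocallyIntegrable f volume) (hρ : ContDiff ℝ 1 ρ) (hρs : HasCompactSupport ρ)
    (hρ0 : ∀ x, 0 ≤ ρ x) (hρ1 : ∫ x, ρ x = 1) {ω : ℝ} (hω : 0 < ω) :
    ∫⁻ y, ENNReal.ofReal (‖fderiv ℝ (ρ ⋆[ContinuousLinearMap.mul ℝ ℝ, volume] f) y‖ - 2 * ω) ≤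
      4 * liminf (fun ε => K n ε f) (𝓝[>] (0 : ℝ)) := by
  set g := ρ ⋆[ContinuousLinearMap.mul ℝ ℝ, volume] f
  have hg : ContDiff ℝ 1 g := hρs.contDiff_convolution_left _ (n := 1) hρ hf
  have hg' : Continuous (fderiv ℝ g) := hg.continuous_fderiv one_ne_zero
  obtain ⟨t, r, htc, -, htr, hcov, hdisj⟩ := Besicovitch.exists_disjoint_closedBall_covering_ae
    (volume : Measure (EuclideanSpace ℝ (Fin n)))
    (fun x => {r | ∀ y ∈ Metric.closedBall x r, ‖fderiv ℝ g y - fderiv ℝ g x‖ ≤ ω}) Set.univ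
    (by
      intro x _ δ hδ
      obtain ⟨s, hs, hsx⟩ := Metric.continuousAt_iff.1 (hg'.continuousAt (x := x)) ω hω
      refine ⟨min s δ / 2, fun y hy => ?_, by positivity, ?_⟩
      · rw [← dist_eq_norm]
        refine (hsx ?_).le
        have h1 : dist y x ≤ min s δ / 2 := hy
        have h2 : 0 < min s δ := by positivity
        linarith [min_le_left s δ]
      · have h2 : 0 < min s δ := by positivity
        linarith [min_le_right s δ])
    (fun _ => 1) (fun _ _ => one_pos)
  have := htc.to_subtype
  choose b hb using fun x : t => exists_orthonormalBasis_apply_eq_norm (fderiv ℝ g x)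
  have hr : ∀ x : t, 0 < r x := fun x => (htr x x.2).2.1
  have hclose : ∀ x : t, ∀ y ∈ Metric.closedBall (x : EuclideanSpace ℝ (Fin n)) (r x),
      ‖fderiv ℝ g y - fderiv ℝ g x‖ ≤ ω := fun x => (htr x x.2).1
  have hvol : ∀ x : t, volume (Metric.closedBall (x : EuclideanSpace ℝ (Fin n)) (r x)) =
      volume (Metric.ball (x : EuclideanSpace ℝ (Fin n)) (r x)) := fun x => by
    rw [Measure.addHaar_closedBall _ _ (hr x).le, Measure.addHaar_ball_of_pos _ _ (hr x)]
  have hK : ∀ ε : ℝ, 0 < ε → ∑' x : t, ENNReal.ofReal ((‖fderiv ℝ g x‖ - ω) / 4) *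
      volume (Metric.ball (x : EuclideanSpace ℝ (Fin n)) (r x - √n * ε)) ≤ K n ε f := by
    intro ε hε
    refine tsum_mul_volume_ball_le_K hε hf hρ hρs hρ0 hρ1 b (fun x => (x : _)) (fun x => r x)
      (fun x => ‖fderiv ℝ g x‖ - ω) ?_ ?_
    · intro x y hxy
      exact (hdisj x.2 y.2 fun h => hxy (Subtype.ext h)).mono Metric.ball_subset_closedBall
        Metric.ball_subset_closedBall
    · intro x y hy
      have h1 := hclose x y (Metric.ball_subset_closedBall hy)
      have h2 : |(fderiv ℝ g y - fderiv ℝ g x) (b x 0)| ≤ ω := by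
        refine ((fderiv ℝ g y - fderiv ℝ g x).le_opNorm (b x 0)).trans ?_
        rw [(b x).norm_eq_one, mul_one]
        exact h1
      rw [← hb x]
      have h3 := (abs_le.1 h2).1
      rw [sub_apply] at h3
      change _ ≤ fderiv ℝ g y (b x 0)
      linarith
  have hsum : ∑' x : t, ENNReal.ofReal ((‖fderiv ℝ g x‖ - ω) / 4) *
      volume (Metric.ball (x : EuclideanSpace ℝ (Fin n)) (r x)) ≤
      liminf (fun ε => K n ε f) (𝓝[>] (0 : ℝ)) := by
    rw [ENNReal.tsum_eq_iSup_sum]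
    refine iSup_le fun s => ?_
    have hlim : Tendsto (fun ε : ℝ => ∑ x ∈ s, ENNReal.ofReal ((‖fderiv ℝ g x‖ - ω) / 4) *
        volume (Metric.ball (x : EuclideanSpace ℝ (Fin n)) (r x - √n * ε))) (𝓝[>] 0)
        (𝓝 (∑ x ∈ s, ENNReal.ofReal ((‖fderiv ℝ g x‖ - ω) / 4) *
          volume (Metric.ball (x : EuclideanSpace ℝ (Fin n)) (r x)))) :=
      tendsto_finsetSum s fun x _ => ENNReal.Tendsto.const_mul
        (tendsto_volume_ball_sub _ (hr x) _) (Or.inr ENNReal.ofReal_ne_top)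
    rw [← hlim.liminf_eq]
    refine liminf_le_liminf ?_
    filter_upwards [self_mem_nhdsWithin] with ε hε
    exact (ENNReal.sum_le_tsum s).trans (hK ε hε)
  have hunion : (⋃ x : t, Metric.closedBall (x : EuclideanSpace ℝ (Fin n)) (r x)) =ᵐ[volume]
      Set.univ := by
    rw [← Set.biUnion_eq_iUnion t (fun x _ => Metric.closedBall x (r x)), ae_eq_univ,
      Set.compl_eq_univ_sdiff]
    exact hcov
  calc ∫⁻ y, ENNReal.ofReal (‖fderiv ℝ g y‖ - 2 * ω)
      = ∫⁻ y in ⋃ x : t, Metric.closedBall (x : EuclideanSpace ℝ (Fin n)) (r x),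
          ENNReal.ofReal (‖fderiv ℝ g y‖ - 2 * ω) := by
        rw [setLIntegral_congr hunion, setLIntegral_univ]
    _ ≤ ∑' x : t, ∫⁻ y in Metric.closedBall (x : EuclideanSpace ℝ (Fin n)) (r x),
          ENNReal.ofReal (‖fderiv ℝ g y‖ - 2 * ω) := lintegral_iUnion_le _ _
    _ ≤ ∑' x : t, 4 * (ENNReal.ofReal ((‖fderiv ℝ g x‖ - ω) / 4) *
          volume (Metric.ball (x : EuclideanSpace ℝ (Fin n)) (r x))) := by
        refine ENNReal.tsum_le_tsum fun x => ?_
        rw [← mul_assoc, ← hvol x, ← setLIntegral_const]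
        refine setLIntegral_mono measurable_const fun y hy => ?_
        rw [show (4 : ℝ≥0∞) = ENNReal.ofReal 4 by simp, ← ENNReal.ofReal_mul (by norm_num)]
        refine ENNReal.ofReal_le_ofReal ?_
        have h1 := hclose x y hy
        have h2 := norm_sub_norm_le (fderiv ℝ g y) (fderiv ℝ g x)
        linarith
    _ ≤ 4 * liminf (fun ε => K n ε f) (𝓝[>] (0 : ℝ)) := by
        rw [ENNReal.tsum_mul_left]
        gcongr

open scoped Convolution in
lemma setLIntegral_norm_fderiv_convolution_le
    (hf : LocallyIntegrable f volume) (hρ : ContDiff ℝ 1 ρ) (hρs : HasCompactSupport ρ)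
    (hρ0 : ∀ x, 0 ≤ ρ x) (hρ1 : ∫ x, ρ x = 1) {S : Set (EuclideanSpace ℝ (Fin n))}
    (hS : volume S ≠ ∞) :
    ∫⁻ y in S, ENNReal.ofReal ‖fderiv ℝ (ρ ⋆[ContinuousLinearMap.mul ℝ ℝ, volume] f) y‖ ≤
      4 * liminf (fun ε => K n ε f) (𝓝[>] (0 : ℝ)) := by
  set g := ρ ⋆[ContinuousLinearMap.mul ℝ ℝ, volume] f
  have hbound : ∀ ω : ℝ, 0 < ω → ∫⁻ y in S, ENNReal.ofReal ‖fderiv ℝ g y‖ ≤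
      4 * liminf (fun ε => K n ε f) (𝓝[>] (0 : ℝ)) + ENNReal.ofReal (2 * ω) * volume S := by
    intro ω hω
    refine le_trans ?_ (add_le_add_left ((setLIntegral_le_lintegral S _).trans
      (lintegral_norm_fderiv_convolution_sub_le hf hρ hρs hρ0 hρ1 hω)) _)
    rw [← setLIntegral_const, ← lintegral_add_right _ measurable_const]
    refine lintegral_mono fun y => ?_
    refine le_trans (ENNReal.ofReal_le_ofReal ?_) ENNReal.ofReal_add_le
    change ‖fderiv ℝ g y‖ ≤ ‖fderiv ℝ g y‖ - 2 * ω + 2 * ω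
    linarith
  have hlim : Tendsto (fun ω : ℝ => 4 * liminf (fun ε => K n ε f) (𝓝[>] (0 : ℝ)) +
      ENNReal.ofReal (2 * ω) * volume S) (𝓝[>] 0)
      (𝓝 (4 * liminf (fun ε => K n ε f) (𝓝[>] (0 : ℝ)) + 0)) := by
    refine tendsto_const_nhds.add ?_
    have h1 : Tendsto (fun ω : ℝ => ENNReal.ofReal (2 * ω)) (𝓝[>] 0) (𝓝 0) := by
      have : Continuous fun ω : ℝ => ENNReal.ofReal (2 * ω) :=
        ENNReal.continuous_ofReal.comp (by fun_prop)
      simpa using (this.tendsto 0).mono_left nhdsWithin_le_nhds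
    simpa using ENNReal.Tendsto.mul_const h1 (Or.inr hS)
  rw [add_zero] at hlim
  exact ge_of_tendsto hlim (by filter_upwards [self_mem_nhdsWithin] with ω hω using hbound ω hω)

end Mollified

section Divergence

variable {φ : EuclideanSpace ℝ (Fin n) → EuclideanSpace ℝ (Fin n)}

lemma continuous_div' (hφ : ContDiff ℝ 1 φ) : Continuous (div' φ) := by
  have h1 : Continuous (fderiv ℝ φ) := hφ.continuous_fderiv one_ne_zero
  unfold div'
  fun_prop

lemma hasCompactSupport_div' (hφs : HasCompactSupport φ) : HasCompactSupport (div' φ) := by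
  refine (hφs.fderiv ℝ).mono fun x hx h0 => hx ?_
  simp [div', show fderiv ℝ φ x = 0 from h0]

lemma integral_mul_div' (hφ : ContDiff ℝ 1 φ) (hφs : HasCompactSupport φ)
    {g : EuclideanSpace ℝ (Fin n) → ℝ} (hg : ContDiff ℝ 1 g) :
    ∫ x, g x * div' φ x = ∫ x, -fderiv ℝ g x (φ x) := by
  have hg' : Continuous (fderiv ℝ g) := hg.continuous_fderiv one_ne_zero
  have hφ' : Continuous (fderiv ℝ φ) := hφ.continuous_fderiv one_ne_zero
  have hgc := hg.continuous
  have hφc := hφ.continuous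
  have hcoord : ∀ i, ContDiff ℝ 1 fun x => φ x i := fun i =>
    (contDiff_euclidean.1 hφ) i
  have hcoord_fderiv : ∀ i x v, fderiv ℝ (fun x => φ x i) x v = fderiv ℝ φ x v i := by
    intro i x v
    have h1 := (EuclideanSpace.proj i : EuclideanSpace ℝ (Fin n) →L[ℝ] ℝ).hasFDerivAt.comp x
      (hφ.differentiable one_ne_zero x).hasFDerivAt
    exact congrArg (fun L : EuclideanSpace ℝ (Fin n) →L[ℝ] ℝ => L v) h1.fderiv
  have hs : ∀ i, HasCompactSupport fun x => φ x i := fun i =>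
    hφs.mono fun x hx h0 => hx (by simp [show φ x = 0 from h0])
  have hs' : ∀ i v, HasCompactSupport fun x => fderiv ℝ φ x v i := fun i v =>
    (hφs.fderiv ℝ).mono fun x hx h0 => hx (by simp [show fderiv ℝ φ x = 0 from h0])
  have hint1 : ∀ i, Integrable fun x => g x * fderiv ℝ φ x (EuclideanSpace.single i 1) i :=
    fun i => Continuous.integrable_of_hasCompactSupport (by fun_prop) (hs' i _).mul_left
  have hint2 : ∀ i, Integrable fun x => fderiv ℝ g x (EuclideanSpace.single i 1) * φ x i :=
    fun i => Continuous.integrable_of_hasCompactSupport (by fun_prop) (hs i).mul_left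
  have hint3 : ∀ i, Integrable fun x => g x * φ x i :=
    fun i => Continuous.integrable_of_hasCompactSupport (by fun_prop) (hs i).mul_left
  have hparts : ∀ i, ∫ x, g x * fderiv ℝ φ x (EuclideanSpace.single i 1) i =
      -∫ x, fderiv ℝ g x (EuclideanSpace.single i 1) * φ x i := by
    intro i
    have := integral_mul_fderiv_eq_neg_fderiv_mul_of_integrable (μ := volume) (f := g)
      (g := fun x => φ x i) (v := EuclideanSpace.single i 1) (hint2 i)
      (by simpa only [hcoord_fderiv] using hint1 i) (hint3 i)
      (fun x _ => hg.differentiable one_ne_zero x)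
      (fun x _ => (hcoord i).differentiable one_ne_zero x)
    simpa only [hcoord_fderiv] using this
  have hexp : ∀ x, fderiv ℝ g x (φ x) =
      ∑ i, fderiv ℝ g x (EuclideanSpace.single i 1) * φ x i := by
    intro x
    conv_lhs => rw [← (EuclideanSpace.basisFun (Fin n) ℝ).sum_repr (φ x)]
    simp [mul_comm]
  simp only [div', Finset.mul_sum, hexp]
  rw [integral_finsetSum _ fun i _ => hint1 i, integral_neg,
    integral_finsetSum _ fun i _ => hint2 i, ← Finset.sum_neg_distrib]
  exact Finset.sum_congr rfl fun i _ => hparts i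

lemma ofReal_integral_mul_div'_le (hφ : ContDiff ℝ 1 φ) (hφs : HasCompactSupport φ)
    (hφ1 : ∀ x, ‖φ x‖ ≤ 1) {g : EuclideanSpace ℝ (Fin n) → ℝ} (hg : ContDiff ℝ 1 g) :
    ENNReal.ofReal (∫ x, g x * div' φ x) ≤
      ∫⁻ x in tsupport φ, ENNReal.ofReal ‖fderiv ℝ g x‖ := by
  rw [integral_mul_div' hφ hφs hg, ← lintegral_indicator (isClosed_tsupport φ).measurableSet]
  refine (ofReal_integral_le_lintegral _).trans (lintegral_mono fun x => ?_)
  by_cases hx : x ∈ tsupport φ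
  · simp only [Set.indicator_of_mem hx]
    refine ENNReal.ofReal_le_ofReal ((neg_le_abs _).trans ?_)
    refine ((fderiv ℝ g x).le_opNorm (φ x)).trans ?_
    exact mul_le_of_le_one_right (norm_nonneg _) (hφ1 x)
  · simp [image_eq_zero_of_notMem_tsupport hx]

open scoped Convolution in
lemma continuous_integral_comp_sub_mul {f ψ : EuclideanSpace ℝ (Fin n) → ℝ}
    (hf : LocallyIntegrable f volume) (hψ : Continuous ψ) (hψs : HasCompactSupport ψ) :
    Continuous fun t => ∫ x, f (x - t) * ψ x := by
  have h1 : HasCompactSupport fun x => ψ (-x) := hψs.comp_homeomorph (Homeomorph.neg _)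
  have h2 := (h1.continuous_convolution_right (ContinuousLinearMap.mul ℝ ℝ) hf
    (hψ.comp continuous_neg)).comp continuous_neg
  refine h2.congr fun t => ?_
  rw [← integral_add_right_eq_self _ t]
  simp only [Function.comp_apply, convolution_def, ContinuousLinearMap.mul_apply',
    add_sub_cancel_right, neg_sub, sub_neg_eq_add]

open scoped Convolution in
lemma ofReal_integral_mul_div'_le_liminf [NeZero n] {f : EuclideanSpace ℝ (Fin n) → ℝ}
    (hf : LocallyIntegrable f volume) (hφ : ContDiff ℝ 1 φ) (hφs : HasCompactSupport φ)
    (hφ1 : ∀ x, ‖φ x‖ ≤ 1) :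
    ENNReal.ofReal (∫ x, f x * div' φ x) ≤
      4 * liminf (fun ε => K n ε f) (𝓝[>] (0 : ℝ)) := by
  have hψ := continuous_div' hφ
  have hψs := hasCompactSupport_div' hφs
  set J : EuclideanSpace ℝ (Fin n) → ℝ := fun t => ∫ x, f (x - t) * div' φ x with hJdef
  have hJ : Continuous J := continuous_integral_comp_sub_mul hf hψ hψs
  have hJ0 : ∫ x, f x * div' φ x = J 0 := by simp [hJdef]
  obtain ⟨C, hC⟩ := hψs.exists_bound_of_continuous hψ
  obtain ⟨R, hR⟩ := hψs.isCompact.isBounded.subset_closedBall (0 : EuclideanSpace ℝ (Fin n))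
  have hconv : ∀ ρ : EuclideanSpace ℝ (Fin n) → ℝ, ContDiff ℝ 1 ρ → HasCompactSupport ρ →
      (∀ x, 0 ≤ ρ x) → ∫ x, ρ x = 1 → ENNReal.ofReal (∫ t, ρ t * J t) ≤
      4 * liminf (fun ε => K n ε f) (𝓝[>] (0 : ℝ)) := by
    intro ρ hρ hρs hρ0 hρ1
    have hg : ContDiff ℝ 1 (ρ ⋆[ContinuousLinearMap.mul ℝ ℝ, volume] f) :=
      hρs.contDiff_convolution_left _ (n := 1) hρ hf
    rw [← integral_convolution_mul hρ.continuous hρs hf hψ.aestronglyMeasurable hC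
      (fun x hx => hR (subset_tsupport _ hx))]
    exact (ofReal_integral_mul_div'_le hφ hφs hφ1 hg).trans
      (setLIntegral_norm_fderiv_convolution_le hf hρ hρs hρ0 hρ1 hφs.isCompact.measure_lt_top.ne)
  rw [hJ0]
  refine le_of_forall_lt_imp_le_of_dense fun c hc => ?_
  have hcfin : c ≠ ∞ := hc.ne_top
  have hcJ : c.toReal < J 0 := by
    rw [← ENNReal.ofReal_toReal hcfin, ENNReal.ofReal_lt_ofReal_iff'] at hc
    exact hc.1
  obtain ⟨δ, hδ, hball⟩ := Metric.eventually_nhds_iff.1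
    (hJ.continuousAt.eventually (lt_mem_nhds hcJ))
  let β : ContDiffBump (0 : EuclideanSpace ℝ (Fin n)) := ⟨δ / 2, δ, by positivity, by linarith⟩
  refine le_trans ?_ (hconv (β.normed volume) β.contDiff_normed β.hasCompactSupport_normed
    β.nonneg_normed β.integral_normed)
  rw [← ENNReal.ofReal_toReal hcfin]
  refine ENNReal.ofReal_le_ofReal ?_
  calc c.toReal = ∫ t, β.normed volume t * c.toReal := by
        rw [integral_mul_const, β.integral_normed, one_mul]
    _ ≤ ∫ t, β.normed volume t * J t := by
        refine integral_mono (β.integrable_normed.mul_const _)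
          ((β.continuous_normed.mul hJ).integrable_of_hasCompactSupport
            β.hasCompactSupport_normed.mul_right) fun t => ?_
        by_cases ht : t ∈ Metric.ball 0 δ
        · exact mul_le_mul_of_nonneg_left (hball ht).le (β.nonneg_normed t)
        · have : β.normed volume t = 0 := by
            rw [← Function.notMem_support, β.support_normed_eq]
            exact ht
          simp [this]

end Divergence

/-- Pointwise lower bound: for every `f ∈ L^1_loc(ℝ^n)`,
`(1/4)·|Df|(ℝ^n) ≤ liminf_{ε→0} K_ε(f)`. -/
theorem stmt18 (n : ℕ) (f : EuclideanSpace ℝ (Fin n) → ℝ)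
    (hf : LocallyIntegrable f volume) :
    totalVariation n f / 4 ≤ liminf (fun ε => K n ε f) (𝓝[>] (0 : ℝ)) := by
  refine ENNReal.div_le_of_le_mul' (iSup_le fun φ => iSup_le fun hφ => iSup_le fun hφs =>
    iSup_le fun hφ1 => ?_)
  rcases Nat.eq_zero_or_pos n with rfl | hn
  · simp [div']
  · have : NeZero n := ⟨hn.ne'⟩
    exact ofReal_integral_mul_div'_le_liminf hf hφ hφs hφ1
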